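/- Let (Ω, Σ) be a measurable space, let μ, μ₁₂, μ₂₃, μ₁₃ be probability measures on Ω with TV(μ_{ij}, μ) ≤ η for each pair, and let Q₁, Q₂, Q₃ : Ω → ℝ be measurable functions taking values in {−1, +1}. Define C_{ij} = ∫ Q_i·Q_j dμ_{ij}. Then C₁₂ + C₂₃ − C₁₃ ≤ 1 + 6η. -/

import Mathlib

open MeasureTheory

/-- Total variation distance between two measures:
the supremum over measurable sets `S` of `|μ S − ν S|`. -/
noncomputable def TV {Λ : Type*} [MeasurableSpace Λ] (μ ν : Measure Λ) : ℝ :=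
  ⨆ S : {S : Set Λ // MeasurableSet S}, |(μ S.1).toReal - (ν S.1).toReal|

lemma integral_pm_one {Ω : Type*} [MeasurableSpace Ω] (ν : Measure Ω) [IsProbabilityMeasure ν]
    (f : Ω → ℝ) (hf : Measurable f) (hv : ∀ ω, f ω = 1 ∨ f ω = -1) :
    ∫ ω, f ω ∂ν = 2 * (ν (f ⁻¹' {1})).toReal - 1 := by
  have hS : MeasurableSet (f ⁻¹' {1}) := hf (measurableSet_singleton 1)
  have h : f = fun ω => (f ⁻¹' {1}).indicator (fun _ => (2 : ℝ)) ω - 1 := by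
    funext ω
    rcases hv ω with h | h
    · simp [Set.indicator, h]; norm_num
    · simp [Set.indicator, h]; norm_num
  conv_lhs => rw [h]
  rw [integral_sub ((integrable_const _).indicator hS) (integrable_const _),
    integral_indicator_const _ hS]
  simp [Measure.real, mul_comm]

lemma abs_le_TV {Ω : Type*} [MeasurableSpace Ω] (μ ν : Measure Ω) [IsProbabilityMeasure μ]
    [IsProbabilityMeasure ν] (S : Set Ω) (hS : MeasurableSet S) :
    |(μ S).toReal - (ν S).toReal| ≤ TV μ ν := by
  refine le_ciSup (f := fun S : {S : Set Ω // MeasurableSet S} =>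
    |(μ S.1).toReal - (ν S.1).toReal|) ⟨1, ?_⟩ ⟨S, hS⟩
  rintro _ ⟨T, rfl⟩
  have h1 : (μ T.1).toReal ≤ 1 := measureReal_le_one
  have h2 : (ν T.1).toReal ≤ 1 := measureReal_le_one
  have h3 : 0 ≤ (μ T.1).toReal := ENNReal.toReal_nonneg
  have h4 : 0 ≤ (ν T.1).toReal := ENNReal.toReal_nonneg
  exact abs_le.2 ⟨by linarith, by linarith⟩

lemma integral_diff_le {Ω : Type*} [MeasurableSpace Ω] (μ ν : Measure Ω) [IsProbabilityMeasure μ]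
    [IsProbabilityMeasure ν] (η : ℝ) (h : TV μ ν ≤ η) (f : Ω → ℝ) (hf : Measurable f)
    (hv : ∀ ω, f ω = 1 ∨ f ω = -1) :
    |∫ ω, f ω ∂μ - ∫ ω, f ω ∂ν| ≤ 2 * η := by
  rw [integral_pm_one μ f hf hv, integral_pm_one ν f hf hv]
  have := abs_le.1 ((abs_le_TV μ ν _ (hf (measurableSet_singleton 1))).trans h)
  exact abs_le.2 ⟨by linarith [this.1], by linarith [this.2]⟩

lemma integrable_pm_one {Ω : Type*} [MeasurableSpace Ω] (ν : Measure Ω) [IsProbabilityMeasure ν]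
    (f : Ω → ℝ) (hf : Measurable f) (hv : ∀ ω, f ω = 1 ∨ f ω = -1) : Integrable f ν :=
  Integrable.of_bound hf.aestronglyMeasurable 1
    (Filter.Eventually.of_forall fun ω => by rcases hv ω with h | h <;> simp [h])

/-- ε-Leggett–Garg inequality: if each two-time measurement context draws
from a probability measure μ_{ij} within total variation η of a common
macrorealist measure μ, and Q₁, Q₂, Q₃ are dichotomic (±1-valued) measurable
observables, then K₃ = C₁₂ + C₂₃ − C₁₃ ≤ 1 + 6η for
C_{ij} = ∫ Q_i·Q_j dμ_{ij}. -/
theorem eps_leggett_garg {Ω : Type*} [MeasurableSpace Ω]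
    (μ μ₁₂ μ₂₃ μ₁₃ : Measure Ω) [IsProbabilityMeasure μ]
    [IsProbabilityMeasure μ₁₂] [IsProbabilityMeasure μ₂₃] [IsProbabilityMeasure μ₁₃]
    (η : ℝ)
    (hTV₁₂ : TV μ₁₂ μ ≤ η) (hTV₂₃ : TV μ₂₃ μ ≤ η) (hTV₁₃ : TV μ₁₃ μ ≤ η)
    (Q₁ Q₂ Q₃ : Ω → ℝ)
    (hm₁ : Measurable Q₁) (hm₂ : Measurable Q₂) (hm₃ : Measurable Q₃)
    (hv₁ : ∀ ω, Q₁ ω = 1 ∨ Q₁ ω = -1)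
    (hv₂ : ∀ ω, Q₂ ω = 1 ∨ Q₂ ω = -1)
    (hv₃ : ∀ ω, Q₃ ω = 1 ∨ Q₃ ω = -1) :
    (∫ ω, Q₁ ω * Q₂ ω ∂μ₁₂) + (∫ ω, Q₂ ω * Q₃ ω ∂μ₂₃) - (∫ ω, Q₁ ω * Q₃ ω ∂μ₁₃)
      ≤ 1 + 6 * η := by
  have hp : ∀ f g : Ω → ℝ, (∀ ω, f ω = 1 ∨ f ω = -1) → (∀ ω, g ω = 1 ∨ g ω = -1) →
      ∀ ω, f ω * g ω = 1 ∨ f ω * g ω = -1 := by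
    intro f g hf hg ω
    rcases hf ω with h | h <;> rcases hg ω with k | k <;> simp [h, k]
  have v12 := hp _ _ hv₁ hv₂
  have v23 := hp _ _ hv₂ hv₃
  have v13 := hp _ _ hv₁ hv₃
  have d12 := (abs_le.1 (integral_diff_le _ _ η hTV₁₂ _ (hm₁.mul hm₂) v12)).2
  have d23 := (abs_le.1 (integral_diff_le _ _ η hTV₂₃ _ (hm₂.mul hm₃) v23)).2
  have d13 := (abs_le.1 (integral_diff_le _ _ η hTV₁₃ _ (hm₁.mul hm₃) v13)).1
  have i12 := integrable_pm_one μ _ (hm₁.mul hm₂) v12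
  have i23 := integrable_pm_one μ _ (hm₂.mul hm₃) v23
  have i13 := integrable_pm_one μ _ (hm₁.mul hm₃) v13
  have key : (∫ ω, Q₁ ω * Q₂ ω ∂μ) + (∫ ω, Q₂ ω * Q₃ ω ∂μ) - (∫ ω, Q₁ ω * Q₃ ω ∂μ) ≤ 1 := by
    have hle : ∫ ω, (Q₁ ω * Q₂ ω + Q₂ ω * Q₃ ω - Q₁ ω * Q₃ ω) ∂μ ≤ ∫ _ω, (1 : ℝ) ∂μ := by
      refine integral_mono ((i12.add i23).sub i13) (integrable_const _) fun ω => ?_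
      rcases hv₁ ω with h1 | h1 <;> rcases hv₂ ω with h2 | h2 <;> rcases hv₃ ω with h3 | h3 <;>
        simp only [h1, h2, h3] <;> norm_num
    have e1 : ∫ ω, (Q₁ ω * Q₂ ω + Q₂ ω * Q₃ ω - Q₁ ω * Q₃ ω) ∂μ =
        (∫ ω, (Q₁ ω * Q₂ ω + Q₂ ω * Q₃ ω) ∂μ) - ∫ ω, Q₁ ω * Q₃ ω ∂μ :=
      integral_sub (i12.add i23) i13
    have e2 : ∫ ω, (Q₁ ω * Q₂ ω + Q₂ ω * Q₃ ω) ∂μ =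
        (∫ ω, Q₁ ω * Q₂ ω ∂μ) + ∫ ω, Q₂ ω * Q₃ ω ∂μ := integral_add i12 i23
    rw [e1, e2] at hle
    simpa using hle
  simp only [Pi.mul_apply] at d12 d23 d13
  linarith
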